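/- arXiv:quant-ph/0007060 — 2 statements merged into one kernel-verified Lean document; each statement's English description precedes it below -/
import Mathlib

section
/- Let m > 0. For real-valued Schwartz functions u₀, u₁ on ℝ³ and t ∈ ℝ, define the time-evolved Cauchy data u_t = 𝓕⁻¹(cos(t·ω_m)·𝓕u₀ + ω_m⁻¹·sin(t·ω_m)·𝓕u₁) and w_t = 𝓕⁻¹(−ω_m·sin(t·ω_m)·𝓕u₀ + cos(t·ω_m)·𝓕u₁). Then K(u_t, w_t) = 𝓕⁻¹(e^{−i t ω_m} · 𝓕(K(u₀, u₁))), i.e., the Newton–Wigner map K intertwines the classical Klein–Gordon time evolution D_t on Cauchy data with the one-parameter unitary group U_t = e^{−itH} on L²(ℝ³;ℂ). -/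
open MeasureTheory Complex FourierTransform SchwartzMap
open scoped SchwartzMap

noncomputable section

/-- Physical space `ℝ³`. -/
abbrev E3 : Type := EuclideanSpace ℝ (Fin 3)

/-- The relativistic dispersion symbol `ω_m(ξ) = √(‖ξ‖² + m²)`. -/
def omegam (m : ℝ) (ξ : E3) : ℝ := Real.sqrt (‖ξ‖ ^ 2 + m ^ 2)

/-- The operator `H^s = (−∇² + m²)^{s/2}`, acting as the Fourier multiplier with symbol
`ω_m^s`: `H^s u = 𝓕⁻¹(ω_m^s · 𝓕u)`. -/
def Hpow (m s : ℝ) (u : E3 → ℂ) : E3 → ℂ :=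
  𝓕⁻ (fun ξ => ((omegam m ξ ^ s : ℝ) : ℂ) * 𝓕 u ξ)

/-- The Newton–Wigner map on Cauchy data: `K(u₀, u₁) = 2^{−1/2}(H^{1/2}u₀ + i·H^{−1/2}u₁)`. -/
def Kmap (m : ℝ) (u₀ u₁ : E3 → ℂ) : E3 → ℂ := fun x =>
  (((2 : ℝ) ^ (-(1 / 2 : ℝ)) : ℝ) : ℂ) *
    (Hpow m (1 / 2) u₀ x + Complex.I * Hpow m (-(1 / 2)) u₁ x)

/-- First component of the time-`t` evolved Klein–Gordon Cauchy data:
`u_t = 𝓕⁻¹(cos(tω_m)·𝓕u₀ + ω_m⁻¹ sin(tω_m)·𝓕u₁)`. -/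
def cauchyEvol₀ (m t : ℝ) (u₀ u₁ : E3 → ℂ) : E3 → ℂ :=
  𝓕⁻ (fun ξ => ((Real.cos (t * omegam m ξ) : ℝ) : ℂ) * 𝓕 u₀ ξ +
    (((omegam m ξ)⁻¹ * Real.sin (t * omegam m ξ) : ℝ) : ℂ) * 𝓕 u₁ ξ)

/-- Second component of the time-`t` evolved Klein–Gordon Cauchy data:
`w_t = 𝓕⁻¹(−ω_m sin(tω_m)·𝓕u₀ + cos(tω_m)·𝓕u₁)`. -/
def cauchyEvol₁ (m t : ℝ) (u₀ u₁ : E3 → ℂ) : E3 → ℂ :=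
  𝓕⁻ (fun ξ => ((-(omegam m ξ * Real.sin (t * omegam m ξ)) : ℝ) : ℂ) * 𝓕 u₀ ξ +
    ((Real.cos (t * omegam m ξ) : ℝ) : ℂ) * 𝓕 u₁ ξ)

theorem Real.hasTemperateGrowth_cos : Real.cos.HasTemperateGrowth :=
  ⟨Real.contDiff_cos, fun n => ⟨0, 1, fun x => by
    simpa [norm_iteratedFDeriv_eq_norm_iteratedDeriv] using
      Real.abs_iteratedDeriv_cos_le_one n x⟩⟩

theorem Real.hasTemperateGrowth_sin : Real.sin.HasTemperateGrowth :=
  ⟨Real.contDiff_sin, fun n => ⟨0, 1, fun x => by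
    simpa [norm_iteratedFDeriv_eq_norm_iteratedDeriv] using
      Real.abs_iteratedDeriv_sin_le_one n x⟩⟩

theorem omegam_pos {m : ℝ} (hm : 0 < m) (ξ : E3) : 0 < omegam m ξ :=
  Real.sqrt_pos.2 (by positivity)

theorem hasTemperateGrowth_omegam_rpow {m : ℝ} (hm : 0 < m) (s : ℝ) :
    (fun ξ => omegam m ξ ^ s).HasTemperateGrowth := by
  have h : (fun ξ => omegam m ξ ^ s) =
      fun ξ => m ^ s * ((fun x : E3 => (1 + ‖x‖ ^ 2) ^ (s / 2)) ∘ (m⁻¹ • ·)) ξ := by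
    ext ξ
    have h₁ : ‖ξ‖ ^ 2 + m ^ 2 = m ^ 2 * (1 + ‖m⁻¹ • ξ‖ ^ 2) := by
      rw [norm_smul, Real.norm_of_nonneg (by positivity)]
      field_simp
      ring
    rw [omegam, h₁, Real.sqrt_mul (by positivity), Real.sqrt_sq hm.le,
      Real.mul_rpow hm.le (by positivity), Real.sqrt_eq_rpow, ← Real.rpow_mul (by positivity)]
    simp only [Function.comp_apply]
    ring_nf
  rw [h]
  have h₂ : ((m⁻¹ • ·) : E3 → E3).HasTemperateGrowth :=
    (m⁻¹ • ContinuousLinearMap.id ℝ E3).hasTemperateGrowth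
  exact (Function.HasTemperateGrowth.const _).mul
    ((Function.hasTemperateGrowth_one_add_norm_sq_rpow E3 (s / 2)).comp h₂)

theorem hasTemperateGrowth_mul_omegam {m : ℝ} (hm : 0 < m) (t : ℝ) :
    (fun ξ => t * omegam m ξ).HasTemperateGrowth := by
  simpa using! (Function.HasTemperateGrowth.const t).mul (hasTemperateGrowth_omegam_rpow hm 1)

theorem hasTemperateGrowth_cos_omegam {m : ℝ} (hm : 0 < m) (t : ℝ) :
    (fun ξ => Real.cos (t * omegam m ξ)).HasTemperateGrowth :=
  Real.hasTemperateGrowth_cos.comp (hasTemperateGrowth_mul_omegam hm t)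

theorem hasTemperateGrowth_sin_omegam {m : ℝ} (hm : 0 < m) (t : ℝ) :
    (fun ξ => Real.sin (t * omegam m ξ)).HasTemperateGrowth :=
  Real.hasTemperateGrowth_sin.comp (hasTemperateGrowth_mul_omegam hm t)

/-- A real symbol of temperate growth times a Schwartz function is a Schwartz function. -/
theorem exists_schwartz_ofReal_mul {g : E3 → ℝ} (hg : g.HasTemperateGrowth) (f : 𝓢(E3, ℂ)) :
    ∃ h : 𝓢(E3, ℂ), ∀ ξ, h ξ = (g ξ : ℂ) * f ξ :=
  ⟨smulLeftCLM ℂ g f, fun ξ => by simp [smulLeftCLM_apply_apply hg]⟩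

theorem fourier_fourierInv_schwartz (f : 𝓢(E3, ℂ)) : 𝓕 (𝓕⁻ (f : E3 → ℂ)) = f := by
  rw [← SchwartzMap.fourierInv_coe, ← SchwartzMap.fourier_coe,
    FourierTransform.fourier_fourierInv_eq]

theorem Hpow_fourierInv (m s : ℝ) (f : 𝓢(E3, ℂ)) :
    Hpow m s (𝓕⁻ (f : E3 → ℂ)) = 𝓕⁻ (fun ξ => ((omegam m ξ ^ s : ℝ) : ℂ) * f ξ) := by
  rw [Hpow, fourier_fourierInv_schwartz]

/-- On the Fourier side, `K` is multiplication by `2^{-1/2} ω^{1/2}` and `2^{-1/2} i ω^{-1/2}`. -/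
theorem exists_Kmap_fourierInv {m : ℝ} (hm : 0 < m) (f g : 𝓢(E3, ℂ)) :
    ∃ h : 𝓢(E3, ℂ), Kmap m (𝓕⁻ (f : E3 → ℂ)) (𝓕⁻ (g : E3 → ℂ)) = 𝓕⁻ (h : E3 → ℂ) ∧
      ∀ ξ, h ξ = (((2 : ℝ) ^ (-(1 / 2 : ℝ)) : ℝ) : ℂ) *
        (((omegam m ξ ^ (1 / 2 : ℝ) : ℝ) : ℂ) * f ξ +
          Complex.I * (((omegam m ξ ^ (-(1 / 2) : ℝ) : ℝ) : ℂ) * g ξ)) := by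
  obtain ⟨a, ha⟩ := exists_schwartz_ofReal_mul (hasTemperateGrowth_omegam_rpow hm (1 / 2)) f
  obtain ⟨b, hb⟩ := exists_schwartz_ofReal_mul (hasTemperateGrowth_omegam_rpow hm (-(1 / 2))) g
  set c : ℂ := (((2 : ℝ) ^ (-(1 / 2 : ℝ)) : ℝ) : ℂ) with hc
  refine ⟨c • (a + Complex.I • b), ?_, fun ξ => by rw [← ha, ← hb]; simp [mul_add]⟩
  ext x
  rw [Kmap, Hpow_fourierInv, Hpow_fourierInv, ← funext ha, ← funext hb]
  simp only [← SchwartzMap.fourierInv_coe]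
  simp [hc, FourierTransform.fourierInv_add, FourierTransform.fourierInv_smul, mul_add]

/-- the Newton–Wigner map `K` intertwines the classical Klein–Gordon time
evolution `D_t` on Cauchy data with the unitary group `U_t = e^{−itH}` on `L²(ℝ³;ℂ)`:
`K(u_t, w_t) = 𝓕⁻¹(e^{−itω_m}·𝓕(K(u₀,u₁)))`. -/
theorem Kmap_intertwines (m : ℝ) (hm : 0 < m) (u₀ u₁ : 𝓢(E3, ℝ)) (t : ℝ) :
    Kmap m (cauchyEvol₀ m t (fun x => (u₀ x : ℂ)) (fun x => (u₁ x : ℂ)))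
        (cauchyEvol₁ m t (fun x => (u₀ x : ℂ)) (fun x => (u₁ x : ℂ))) =
      𝓕⁻ (fun ξ => Complex.exp (-(Complex.I * t * omegam m ξ)) *
        𝓕 (Kmap m (fun x => (u₀ x : ℂ)) (fun x => (u₁ x : ℂ))) ξ) := by
  set v₀ : 𝓢(E3, ℂ) := SchwartzMap.postcompCLM Complex.ofRealCLM u₀
  set v₁ : 𝓢(E3, ℂ) := SchwartzMap.postcompCLM Complex.ofRealCLM u₁
  change Kmap m (cauchyEvol₀ m t v₀ v₁) (cauchyEvol₁ m t v₀ v₁) =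
    𝓕⁻ (fun ξ => Complex.exp (-(Complex.I * t * omegam m ξ)) * 𝓕 (Kmap m v₀ v₁) ξ)
  have inv (v : 𝓢(E3, ℂ)) : (v : E3 → ℂ) = 𝓕⁻ ((𝓕 v : 𝓢(E3, ℂ)) : E3 → ℂ) := by
    rw [← SchwartzMap.fourierInv_coe, FourierTransform.fourierInv_fourier_eq]
  have hω := hasTemperateGrowth_omegam_rpow hm
  have hcos := hasTemperateGrowth_cos_omegam hm t
  have hsin := hasTemperateGrowth_sin_omegam hm t
  have h_inv : (fun ξ => (omegam m ξ)⁻¹ * Real.sin (t * omegam m ξ)).HasTemperateGrowth := by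
    simpa [Real.rpow_neg_one] using! (hω (-1)).mul hsin
  have h_mul : (fun ξ => -(omegam m ξ * Real.sin (t * omegam m ξ))).HasTemperateGrowth := by
    simpa using! ((hω 1).mul hsin).neg
  obtain ⟨a, ha⟩ := exists_schwartz_ofReal_mul hcos (𝓕 v₀)
  obtain ⟨b, hb⟩ := exists_schwartz_ofReal_mul h_inv (𝓕 v₁)
  obtain ⟨c, hc⟩ := exists_schwartz_ofReal_mul h_mul (𝓕 v₀)
  obtain ⟨d, hd⟩ := exists_schwartz_ofReal_mul hcos (𝓕 v₁)
  have e₀ : cauchyEvol₀ m t v₀ v₁ = 𝓕⁻ ((a + b : 𝓢(E3, ℂ)) : E3 → ℂ) := by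
    rw [cauchyEvol₀]
    congr 1
    ext ξ
    simp [ha, hb, SchwartzMap.fourier_coe]
  have e₁ : cauchyEvol₁ m t v₀ v₁ = 𝓕⁻ ((c + d : 𝓢(E3, ℂ)) : E3 → ℂ) := by
    rw [cauchyEvol₁]
    congr 1
    ext ξ
    simp [hc, hd, SchwartzMap.fourier_coe]
  obtain ⟨h, hK, hh⟩ := exists_Kmap_fourierInv hm (a + b) (c + d)
  obtain ⟨k, hK', hk⟩ := exists_Kmap_fourierInv hm (𝓕 v₀) (𝓕 v₁)
  rw [← inv, ← inv] at hK'
  rw [e₀, e₁, hK, hK', fourier_fourierInv_schwartz]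
  congr 1
  ext ξ
  have hpos := omegam_pos hm ξ
  have hexp : Complex.exp (-(Complex.I * t * omegam m ξ)) =
      (Real.cos (t * omegam m ξ) : ℂ) - Real.sin (t * omegam m ξ) * Complex.I := by
    rw [show -(Complex.I * t * omegam m ξ) = ((-(t * omegam m ξ) : ℝ) : ℂ) * Complex.I by
      push_cast; ring, Complex.exp_mul_I, ← Complex.ofReal_cos, ← Complex.ofReal_sin]
    simp [sub_eq_add_neg]
  have r₁ : (omegam m ξ : ℂ) * ((omegam m ξ ^ (-(1 / 2) : ℝ) : ℝ) : ℂ) =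
      ((omegam m ξ ^ (1 / 2 : ℝ) : ℝ) : ℂ) := by
    rw [← Complex.ofReal_mul, ← Real.rpow_one_add' hpos.le (by norm_num)]
    norm_num
  have hne : (omegam m ξ : ℂ) ≠ 0 := by exact_mod_cast hpos.ne'
  rw [hh, hk, hexp, ← r₁]
  simp only [add_apply, ha, hb, hc, hd]
  push_cast
  field_simp
  ring_nf
  simp only [Complex.I_sq]
  ring

end
end

section
/- Let m > 0 and let G₁, G₂ ⊆ ℝ³ be disjoint nonempty open sets. Then there exist smooth compactly supported real-valued functions u, v on ℝ³ with supp(u) ⊆ G₁ and supp(v) ⊆ G₂ such that ⟪u, H v⟫ ≠ 0. (Hence the subspaces of Cauchy data localized in disjoint regions are not orthogonal with respect to the real part of the one-particle inner product, and the vacuum is not a product state across the standard local algebras.) -/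
open MeasureTheory Complex FourierTransform

noncomputable section

/-- The heat kernel on `ℝ³`, the inverse Fourier transform of `ξ ↦ exp (-t * ‖ξ‖ ^ 2)`. -/
def heatKernel (t : ℝ) (x : E3) : ℝ :=
  (Real.pi / t) ^ (3 / 2 : ℝ) * Real.exp (-Real.pi ^ 2 * ‖x‖ ^ 2 / t)

theorem heatKernel_pos {t : ℝ} (ht : 0 < t) (x : E3) : 0 < heatKernel t x := by
  unfold heatKernel
  positivity

@[fun_prop]
theorem continuous_heatKernel (t : ℝ) : Continuous (heatKernel t) := by
  unfold heatKernel
  fun_prop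

theorem integral_mul_fourierInv {f h : E3 → ℂ} (hf : Integrable f) (hh : Integrable h) :
    ∫ x, f x * 𝓕⁻ h x = ∫ ξ, 𝓕⁻ f ξ * h ξ := by
  have hL : Continuous fun p : E3 × E3 => (-innerₗ E3) p.1 p.2 := continuous_inner.neg
  have hflip : (-innerₗ E3).flip = -innerₗ E3 := by
    ext x y
    simp [real_inner_comm]
  have key := VectorFourier.integral_fourierIntegral_smul_eq_flip (L := -innerₗ E3)
    Real.continuous_fourierChar hL hf hh
  rw [hflip] at key
  exact key.symm

theorem fourierInv_gaussian_mul_fourier {t : ℝ} (ht : 0 < t) {g : E3 → ℂ} (hg : Integrable g)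
    (x : E3) :
    𝓕⁻ (fun ξ => cexp (-t * ‖ξ‖ ^ 2) * 𝓕 g ξ) x = ∫ y, (heatKernel t (x - y) : ℂ) * g y := by
  have htc : 0 < (t : ℂ).re := by simpa using ht
  have J : Integrable (fun ξ : E3 =>
      cexp (-t * ‖ξ‖ ^ 2 + 2 * Real.pi * Complex.I * inner ℝ x ξ)) :=
    GaussianFourier.integrable_cexp_neg_mul_sq_norm_add htc _ _
  have key := VectorFourier.integral_fourierIntegral_smul_eq_flip (L := innerₗ E3)
    Real.continuous_fourierChar continuous_inner J hg
  rw [flip_innerₗ] at key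
  change ∫ y, 𝓕 (fun ξ : E3 =>
      cexp (-t * ‖ξ‖ ^ 2 + 2 * Real.pi * Complex.I * inner ℝ x ξ)) y • g y =
    ∫ ξ, cexp (-t * ‖ξ‖ ^ 2 + 2 * Real.pi * Complex.I * inner ℝ x ξ) • 𝓕 g ξ at key
  rw [Real.fourierInv_eq']
  calc _ = ∫ ξ, cexp (-t * ‖ξ‖ ^ 2 + 2 * Real.pi * Complex.I * inner ℝ x ξ) • 𝓕 g ξ := by
        congr with ξ
        rw [smul_eq_mul, smul_eq_mul, ← mul_assoc, ← Complex.exp_add, real_inner_comm]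
        congr 2
        push_cast
        ring
    _ = _ := by
        rw [← key]
        congr with y
        rw [fourier_gaussian_innerProductSpace' htc, smul_eq_mul]
        congr 1
        simp only [heatKernel, finrank_euclideanSpace, Fintype.card_fin]
        push_cast
        rw [Complex.ofReal_cpow (by positivity)]
        push_cast
        rfl

theorem continuous_heatConv (t : ℝ) {v : E3 → ℝ} (hv : Continuous v) (hvc : HasCompactSupport v) :
    Continuous fun x => ∫ y, heatKernel t (x - y) * v y := by
  have h : ∀ x, ∫ y, heatKernel t (x - y) * v y = ∫ y in tsupport v, heatKernel t (x - y) * v y :=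
    fun x => (setIntegral_eq_integral_of_forall_compl_eq_zero fun y hy => by
      rw [image_eq_zero_of_notMem_tsupport hy, mul_zero]).symm
  simp_rw [h]
  exact continuous_parametric_integral_of_continuous (by fun_prop) hvc.isCompact

theorem heatPairing_pos {t : ℝ} (ht : 0 < t) {u v : E3 → ℝ} (hu : Continuous u)
    (huc : HasCompactSupport u) (hu0 : 0 ≤ u) {a : E3} (ha : u a ≠ 0) (hv : Continuous v)
    (hvc : HasCompactSupport v) (hv0 : 0 ≤ v) {b : E3} (hb : v b ≠ 0) :
    0 < ∫ x, u x * ∫ y, heatKernel t (x - y) * v y := by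
  have hpos : ∀ x, 0 < ∫ y, heatKernel t (x - y) * v y := fun x =>
    Continuous.integral_pos_of_hasCompactSupport_nonneg_nonzero (x := b) (by fun_prop)
      hvc.mul_left (fun y => mul_nonneg (heatKernel_pos ht _).le (hv0 y))
      (mul_ne_zero (heatKernel_pos ht _).ne' hb)
  exact Continuous.integral_pos_of_hasCompactSupport_nonneg_nonzero (x := a)
    (hu.mul (continuous_heatConv t hv hvc)) huc.mul_right
    (fun x => mul_nonneg (hu0 x) (hpos x).le) (mul_ne_zero ha (hpos a).ne')

theorem integrableOn_one_sub_exp_neg_mul_rpow :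
    IntegrableOn (fun s : ℝ => (1 - Real.exp (-s)) * s ^ (-(3 / 2) : ℝ)) (Set.Ioi 0) := by
  have hm : Measurable fun s : ℝ => (1 - Real.exp (-s)) * s ^ (-(3 / 2) : ℝ) := by fun_prop
  rw [← Set.Ioc_union_Ioi_eq_Ioi zero_le_one]
  refine IntegrableOn.union ?_ ?_
  · have h : IntegrableOn (fun s : ℝ => s ^ (-(1 / 2) : ℝ)) (Set.Ioc 0 1) :=
      (intervalIntegrable_iff_integrableOn_Ioc_of_le zero_le_one).1
        (intervalIntegral.intervalIntegrable_rpow' (by norm_num))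
    refine h.mono' hm.aestronglyMeasurable ?_
    filter_upwards [ae_restrict_mem measurableSet_Ioc] with s hs
    have h1 : Real.exp (-s) ≤ 1 := Real.exp_le_one_iff.2 (by linarith [hs.1])
    have h2 := Real.add_one_le_exp (-s)
    have h3 : s ^ (-(1 / 2) : ℝ) = s * s ^ (-(3 / 2) : ℝ) := by
      rw [← Real.rpow_one_add' hs.1.le (by norm_num)]
      norm_num
    have h4 := Real.rpow_nonneg hs.1.le (-(3 / 2) : ℝ)
    rw [Real.norm_of_nonneg (mul_nonneg (by linarith) h4), h3]
    exact mul_le_mul_of_nonneg_right (by linarith) h4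
  · refine (integrableOn_Ioi_rpow_of_lt (a := -(3 / 2)) (by norm_num) one_pos).mono'
      hm.aestronglyMeasurable ?_
    filter_upwards [ae_restrict_mem measurableSet_Ioi] with s hs
    have hs0 : (0 : ℝ) < s := one_pos.trans hs
    have h1 : Real.exp (-s) ≤ 1 := Real.exp_le_one_iff.2 (by linarith)
    have h4 := Real.rpow_nonneg hs0.le (-(3 / 2) : ℝ)
    rw [Real.norm_of_nonneg (mul_nonneg (by linarith) h4)]
    exact mul_le_of_le_one_left h4 (by linarith [Real.exp_pos (-s)])

/-- The integrand of the subordination formula for `a ^ (1 / 2)`. -/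
theorem subordination_eq {a t : ℝ} (ha : 0 < a) (ht : 0 < t) :
    (1 - Real.exp (-(a * t))) * t ^ (-(3 / 2) : ℝ) =
      a ^ (3 / 2 : ℝ) * ((1 - Real.exp (-(a * t))) * (a * t) ^ (-(3 / 2) : ℝ)) := by
  rw [Real.mul_rpow ha.le ht.le, Real.rpow_neg ha.le]
  have : a ^ (3 / 2 : ℝ) ≠ 0 := (Real.rpow_pos_of_pos ha _).ne'
  field_simp

theorem integrableOn_subordination {a : ℝ} (ha : 0 < a) :
    IntegrableOn (fun t : ℝ => (1 - Real.exp (-(a * t))) * t ^ (-(3 / 2) : ℝ)) (Set.Ioi 0) := by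
  refine IntegrableOn.congr_fun (f := fun t : ℝ => a ^ (3 / 2 : ℝ) *
    ((1 - Real.exp (-(a * t))) * (a * t) ^ (-(3 / 2) : ℝ))) ?_
    (fun t ht => (subordination_eq ha ht).symm) measurableSet_Ioi
  refine Integrable.const_mul ?_ _
  have := (integrableOn_Ioi_comp_mul_left_iff
    (fun s : ℝ => (1 - Real.exp (-s)) * s ^ (-(3 / 2) : ℝ)) 0 ha).2
    (by simpa using integrableOn_one_sub_exp_neg_mul_rpow)
  exact this

theorem integral_subordination {a : ℝ} (ha : 0 < a) :
    ∫ t in Set.Ioi (0 : ℝ), (1 - Real.exp (-(a * t))) * t ^ (-(3 / 2) : ℝ) =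
      Real.sqrt a * ∫ s in Set.Ioi (0 : ℝ), (1 - Real.exp (-s)) * s ^ (-(3 / 2) : ℝ) := by
  rw [setIntegral_congr_fun measurableSet_Ioi fun t ht => subordination_eq ha ht,
    integral_const_mul, integral_comp_mul_left_Ioi
      (fun s : ℝ => (1 - Real.exp (-s)) * s ^ (-(3 / 2) : ℝ)) 0 ha, mul_zero, smul_eq_mul,
    ← mul_assoc, ← Real.rpow_neg_one, ← Real.rpow_add ha, Real.sqrt_eq_rpow]
  norm_num

theorem omegam_nonneg (m : ℝ) (ξ : E3) : 0 ≤ omegam m ξ :=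
  Real.sqrt_nonneg _

@[fun_prop]
theorem continuous_omegam (m : ℝ) : Continuous (omegam m) := by
  unfold omegam
  fun_prop

/-- The subordination formula for `ω_m`, integrated against a function `F`. -/
theorem subordination_integral {m : ℝ} (hm : 0 < m) {F : E3 → ℂ} (hFc : Continuous F)
    (hF : Integrable F) (hωF : Integrable fun ξ => (omegam m ξ : ℂ) * F ξ) :
    IntegrableOn (fun t : ℝ => ((t ^ (-(3 / 2) : ℝ) : ℝ) : ℂ) *
      ((∫ ξ, F ξ) - ∫ ξ, (Real.exp (-((‖ξ‖ ^ 2 + m ^ 2) * t)) : ℂ) * F ξ)) (Set.Ioi 0) ∧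
    ∫ t in Set.Ioi (0 : ℝ), ((t ^ (-(3 / 2) : ℝ) : ℝ) : ℂ) *
      ((∫ ξ, F ξ) - ∫ ξ, (Real.exp (-((‖ξ‖ ^ 2 + m ^ 2) * t)) : ℂ) * F ξ) =
    ((∫ s in Set.Ioi (0 : ℝ), (1 - Real.exp (-s)) * s ^ (-(3 / 2) : ℝ) : ℝ) : ℂ) *
      ∫ ξ, (omegam m ξ : ℂ) * F ξ := by
  have hpos : ∀ ξ : E3, 0 < ‖ξ‖ ^ 2 + m ^ 2 := fun ξ => by positivity
  let K : E3 → ℝ → ℝ := fun ξ t =>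
    (1 - Real.exp (-((‖ξ‖ ^ 2 + m ^ 2) * t))) * t ^ (-(3 / 2) : ℝ)
  have hK0 : ∀ ξ t, 0 < t → 0 ≤ K ξ t := fun ξ t ht => by
    refine mul_nonneg (sub_nonneg.2 (Real.exp_le_one_iff.2 ?_)) (Real.rpow_nonneg ht.le _)
    have := mul_pos (hpos ξ) ht
    linarith
  have hKint : ∀ ξ, ∫ t in Set.Ioi 0, K ξ t = omegam m ξ *
      ∫ s in Set.Ioi (0 : ℝ), (1 - Real.exp (-s)) * s ^ (-(3 / 2) : ℝ) := fun ξ =>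
    integral_subordination (hpos ξ)
  have hmeas : Measurable (Function.uncurry fun ξ t => (K ξ t : ℂ) * F ξ) := by
    have := hFc.measurable
    unfold Function.uncurry K
    fun_prop
  have hint : Integrable (Function.uncurry fun ξ t => (K ξ t : ℂ) * F ξ)
      (volume.prod (volume.restrict (Set.Ioi 0))) := by
    refine (integrable_prod_iff hmeas.aestronglyMeasurable).2
      ⟨.of_forall fun ξ => (integrableOn_subordination (hpos ξ)).ofReal.mul_const (F ξ), ?_⟩
    have h : ∀ ξ, ∫ t in Set.Ioi 0, ‖(K ξ t : ℂ) * F ξ‖ =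
        ‖(omegam m ξ : ℂ) * F ξ‖ *
          ∫ s in Set.Ioi (0 : ℝ), (1 - Real.exp (-s)) * s ^ (-(3 / 2) : ℝ) := fun ξ => by
      rw [setIntegral_congr_fun (g := fun t => K ξ t * ‖F ξ‖) measurableSet_Ioi fun t ht => by
        simp [abs_of_nonneg (hK0 ξ t ht)], integral_mul_const, hKint, norm_mul,
        Complex.norm_of_nonneg (omegam_nonneg m ξ)]
      ring
    simp only [Function.uncurry, h]
    exact hωF.norm.mul_const _
  have hinner : ∀ t ∈ Set.Ioi (0 : ℝ), ∫ ξ, (K ξ t : ℂ) * F ξ = ((t ^ (-(3 / 2) : ℝ) : ℝ) : ℂ) *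
      ((∫ ξ, F ξ) - ∫ ξ, (Real.exp (-((‖ξ‖ ^ 2 + m ^ 2) * t)) : ℂ) * F ξ) := fun t ht => by
    have hE : Integrable fun ξ => (Real.exp (-((‖ξ‖ ^ 2 + m ^ 2) * t)) : ℂ) * F ξ := by
      refine hF.bdd_mul (c := 1) (by fun_prop) (.of_forall fun ξ => ?_)
      rw [Complex.norm_of_nonneg (Real.exp_pos _).le, Real.exp_le_one_iff]
      have := mul_pos (hpos ξ) ht
      linarith
    rw [← integral_sub hF hE, ← integral_const_mul]
    congr with ξ
    simp only [K]
    push_cast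
    ring
  constructor
  · exact IntegrableOn.congr_fun hint.integral_prod_right hinner measurableSet_Ioi
  · rw [← setIntegral_congr_fun measurableSet_Ioi hinner, ← integral_integral_swap hint,
      ← integral_const_mul]
    congr with ξ
    rw [integral_mul_const, integral_complex_ofReal, hKint]
    push_cast
    ring

theorem integrable_omegam_mul (m : ℝ) (g : SchwartzMap E3 ℂ) :
    Integrable fun ξ => (omegam m ξ : ℂ) * g ξ := by
  have h1 := g.integrable_pow_mul volume 1
  have h2 := (g.integrable (μ := volume)).norm.const_mul |m|
  refine (h1.add h2).mono' (by fun_prop) (.of_forall fun ξ => ?_)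
  have h : omegam m ξ ≤ ‖ξ‖ + |m| := by
    refine Real.sqrt_le_iff.2 ⟨by positivity, ?_⟩
    nlinarith [sq_abs m, mul_nonneg (norm_nonneg ξ) (abs_nonneg m)]
  rw [norm_mul, Complex.norm_of_nonneg (omegam_nonneg m ξ), Pi.add_apply, pow_one, ← add_mul]
  gcongr

/-- If `u, v ≥ 0` are nonzero and `u * v = 0`, then `⟪u, H v⟫ ≠ 0`: by subordination, a multiple of
`⟪u, H v⟫` is minus an average over `t > 0` of the positive heat pairings of `u` and `v`. -/
theorem integral_mul_Hpow_ne_zero {m : ℝ} (hm : 0 < m) {u v : E3 → ℝ}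
    (hu : ContDiff ℝ (⊤ : ℕ∞) u) (huc : HasCompactSupport u) (hu0 : 0 ≤ u) {a : E3} (ha : u a ≠ 0)
    (hv : ContDiff ℝ (⊤ : ℕ∞) v) (hvc : HasCompactSupport v) (hv0 : 0 ≤ v) {b : E3} (hb : v b ≠ 0)
    (huv : ∀ x, u x * v x = 0) :
    ∫ x : E3, (u x : ℂ) * Hpow m 1 (fun y => (v y : ℂ)) x ≠ 0 := by
  let f : SchwartzMap E3 ℂ := (huc.comp_left (g := ((↑) : ℝ → ℂ)) rfl).toSchwartzMap
    (Complex.ofRealCLM.contDiff.comp hu)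
  let g : SchwartzMap E3 ℂ := (hvc.comp_left (g := ((↑) : ℝ → ℂ)) rfl).toSchwartzMap
    (Complex.ofRealCLM.contDiff.comp hv)
  have hg : ∀ x, g x = v x := fun x => rfl
  have hfInv : 𝓕⁻ (fun x => (u x : ℂ)) = ⇑(𝓕⁻ f : SchwartzMap E3 ℂ) := (SchwartzMap.fourierInv_coe f).symm
  have hgF : 𝓕 (fun x => (v x : ℂ)) = ⇑(𝓕 g : SchwartzMap E3 ℂ) := (SchwartzMap.fourier_coe g).symm
  have hui : Integrable fun x => (u x : ℂ) := f.integrable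
  have hvi : Integrable fun x => (v x : ℂ) := g.integrable
  let F : E3 → ℂ := fun ξ => 𝓕⁻ f ξ * 𝓕 g ξ
  have hFc : Continuous F := by fun_prop
  obtain ⟨c, hc⟩ : ∃ c, ∀ ξ, ‖𝓕⁻ f ξ‖ ≤ c := by
    obtain ⟨c, -, hc⟩ := (𝓕⁻ f).decay 0 0
    exact ⟨c, fun ξ => by simpa using hc ξ⟩
  have hbdd : ∀ {h : E3 → ℂ}, Integrable h → Integrable fun ξ => 𝓕⁻ f ξ * h ξ := fun hh =>
    hh.bdd_mul (by fun_prop) (.of_forall hc)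
  have hF : Integrable F := hbdd (𝓕 g).integrable
  have hωF : Integrable fun ξ => (omegam m ξ : ℂ) * F ξ :=
    (hbdd (integrable_omegam_mul m (𝓕 g))).congr (.of_forall fun ξ => mul_left_comm _ _ _)
  have hFzero : ∫ ξ, F ξ = 0 := by
    have h := integral_mul_fourierInv hui (𝓕 g).integrable
    rw [hfInv, ← SchwartzMap.fourierInv_coe, FourierTransform.fourierInv_fourier_eq] at h
    rw [← h]
    simp [hg, ← Complex.ofReal_mul, huv]
  have hgauss : ∀ t ∈ Set.Ioi (0 : ℝ), ∫ ξ, (Real.exp (-((‖ξ‖ ^ 2 + m ^ 2) * t)) : ℂ) * F ξ =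
      ((Real.exp (-(m ^ 2 * t)) * ∫ x, u x * ∫ y, heatKernel t (x - y) * v y : ℝ) : ℂ) := by
    intro t ht
    have hgi : Integrable fun ξ : E3 => cexp (-t * ‖ξ‖ ^ 2) * 𝓕 g ξ := by
      refine (𝓕 g).integrable.bdd_mul (c := 1) (by fun_prop) (.of_forall fun ξ => ?_)
      have : 0 ≤ t * ‖ξ‖ ^ 2 := mul_nonneg (le_of_lt ht) (by positivity)
      rw [Complex.norm_exp, Real.exp_le_one_iff]
      norm_cast
      linarith
    have h := integral_mul_fourierInv hui hgi
    simp_rw [hfInv, ← hgF, fourierInv_gaussian_mul_fourier ht hvi,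
      ← Complex.ofReal_mul, integral_complex_ofReal, ← Complex.ofReal_mul,
      integral_complex_ofReal, hgF] at h
    rw [Complex.ofReal_mul, h, ← integral_const_mul]
    congr with ξ
    rw [add_mul, neg_add, Real.exp_add]
    push_cast
    rw [← mul_comm (t : ℂ), ← neg_mul]
    simp only [F]
    ring
  obtain ⟨hi, he⟩ := subordination_integral hm hFc hF hωF
  have hI : ∫ x : E3, (u x : ℂ) * Hpow m 1 (fun y => (v y : ℂ)) x =
      ∫ ξ, (omegam m ξ : ℂ) * F ξ := by
    unfold Hpow
    simp_rw [Real.rpow_one, hgF]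
    rw [integral_mul_fourierInv hui (integrable_omegam_mul m (𝓕 g)), hfInv]
    congr with ξ
    exact mul_left_comm _ _ _
  rw [hI]
  intro h0
  have hcongr : ∀ t ∈ Set.Ioi (0 : ℝ), ((t ^ (-(3 / 2) : ℝ) : ℝ) : ℂ) *
      ((∫ ξ, F ξ) - ∫ ξ, (Real.exp (-((‖ξ‖ ^ 2 + m ^ 2) * t)) : ℂ) * F ξ) =
      ((-(t ^ (-(3 / 2) : ℝ) * (Real.exp (-(m ^ 2 * t)) *
        ∫ x, u x * ∫ y, heatKernel t (x - y) * v y)) : ℝ) : ℂ) := fun t ht => by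
    rw [hFzero, hgauss t ht]
    push_cast
    ring
  rw [h0, mul_zero, setIntegral_congr_fun measurableSet_Ioi hcongr, integral_complex_ofReal,
    integral_neg, Complex.ofReal_eq_zero, neg_eq_zero] at he
  have hi' : IntegrableOn (fun t : ℝ => t ^ (-(3 / 2) : ℝ) * (Real.exp (-(m ^ 2 * t)) *
      ∫ x, u x * ∫ y, heatKernel t (x - y) * v y)) (Set.Ioi 0) := by
    exact (hi.congr_fun hcongr measurableSet_Ioi).re.neg.congr (.of_forall fun t => neg_neg _)
  have hpos : ∀ t ∈ Set.Ioi (0 : ℝ), 0 < t ^ (-(3 / 2) : ℝ) * (Real.exp (-(m ^ 2 * t)) *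
      ∫ x, u x * ∫ y, heatKernel t (x - y) * v y) := fun t ht =>
    mul_pos (Real.rpow_pos_of_pos ht _) (mul_pos (Real.exp_pos _)
      (heatPairing_pos ht hu.continuous huc hu0 ha hv.continuous hvc hv0 hb))
  refine he.not_gt ((setIntegral_pos_iff_support_of_nonneg_ae ?_ hi').2 ?_)
  · filter_upwards [ae_restrict_mem measurableSet_Ioi] with t ht using (hpos t ht).le
  · rw [Set.inter_eq_right.2 fun t ht => Function.mem_support.2 (hpos t ht).ne']
    simp

/-- for `m > 0` and disjoint nonempty open `G₁, G₂ ⊆ ℝ³`, there are smooth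
compactly supported real-valued `u, v` supported in `G₁`, `G₂` respectively with
`⟪u, H v⟫ ≠ 0`. -/
theorem exists_nonorthogonal_H (m : ℝ) (hm : 0 < m)
    (G₁ G₂ : Set E3) (hG₁ : IsOpen G₁) (hG₂ : IsOpen G₂) (hdisj : Disjoint G₁ G₂)
    (hG₁ne : G₁.Nonempty) (hG₂ne : G₂.Nonempty) :
    ∃ u v : E3 → ℝ,
      ContDiff ℝ (⊤ : ℕ∞) u ∧ HasCompactSupport u ∧ tsupport u ⊆ G₁ ∧
      ContDiff ℝ (⊤ : ℕ∞) v ∧ HasCompactSupport v ∧ tsupport v ⊆ G₂ ∧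
      ∫ x : E3, (starRingEnd ℂ) (u x) * Hpow m 1 (fun y => (v y : ℂ)) x ≠ 0 := by
  obtain ⟨a, ha⟩ := hG₁ne
  obtain ⟨b, hb⟩ := hG₂ne
  obtain ⟨u, hus, huc, hu, hur, hua⟩ :=
    exists_contDiff_tsupport_subset (n := ⊤) (hG₁.mem_nhds ha)
  obtain ⟨v, hvs, hvc, hv, hvr, hvb⟩ :=
    exists_contDiff_tsupport_subset (n := ⊤) (hG₂.mem_nhds hb)
  refine ⟨u, v, hu, huc, hus, hv, hvc, hvs, ?_⟩
  simp_rw [Complex.conj_ofReal]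
  refine integral_mul_Hpow_ne_zero hm hu huc (fun x => (hur ⟨x, rfl⟩).1) (a := a) (by simp [hua])
    hv hvc (fun x => (hvr ⟨x, rfl⟩).1) (b := b) (by simp [hvb]) fun x => ?_
  by_contra hne
  exact hdisj.notMem_of_mem_left
    (hus (subset_tsupport u (left_ne_zero_of_mul hne)))
    (hvs (subset_tsupport v (right_ne_zero_of_mul hne)))

end
end
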